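/- Let a, b, c, d be real with t = a+b+c+d, let n ≥ k ≥ 0 be integers, and let (x,y) be real with x ≠ 1; write u(x,y) = P_{n,k}^{(a,b,c,d)}(x,y). Then (a + xk/(1−x))·u + x·∂u/∂x − (xy/(1−x))·∂u/∂y = (n−k+a)·P_{n,k}^{(a−1,b,c,d+1)}(x,y), and (k+b+c+d+1)·u − (1−x)·∂u/∂x + y·∂u/∂y = (n+k+t−a+1)·P_{n,k}^{(a+1,b,c,d−1)}(x,y). -/

import Mathlib

noncomputable section

/-- Generalized binomial coefficient `C(α, j) = α(α−1)⋯(α−j+1)/j!`. -/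
def genBinom (α : ℝ) (j : ℕ) : ℝ :=
  (∏ i ∈ Finset.range j, (α - i)) / (Nat.factorial j)

/-- Jacobi polynomial `P_n^{(a,b)}(x)`; zero for negative `n`. -/
def jacobiP (n : ℤ) (a b : ℝ) (x : ℝ) : ℝ :=
  if n < 0 then 0 else
    ∑ m ∈ Finset.range (n.toNat + 1),
      genBinom ((n : ℝ) + a) (n.toNat - m) * genBinom ((n : ℝ) + b) m *
        ((x - 1) / 2) ^ m * ((x + 1) / 2) ^ (n.toNat - m)

/-- Four-parameter Koornwinder polynomial `P_{n,k}^{(a,b,c,d)}(x,y)`;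
zero whenever `k < 0`, `n < 0`, or `k > n` (covering the conventions
`k = −1`, `n = −1`, `k = n+1`). -/
def koornP (n k : ℤ) (a b c d : ℝ) (x y : ℝ) : ℝ :=
  if n < 0 ∨ k < 0 ∨ n < k then 0 else
    jacobiP (n - k) (2 * (k : ℝ) + b + c + d + 1) a (2 * x - 1) *
      (1 - x) ^ k.toNat * jacobiP k c b (-1 + 2 * y / (1 - x))

open Finset.HasAntidiagonal in
/-- The homogeneous form `∑_{i+j=N} C(p, j) C(q, i) X^i Y^j` underlying the Jacobi polynomials. -/
def jacobiForm (N : ℕ) (p q X Y : ℝ) : ℝ :=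
  ∑ ij ∈ antidiagonal N, genBinom p ij.2 * genBinom q ij.1 * X ^ ij.1 * Y ^ ij.2

open Finset.HasAntidiagonal in
/-- The derivative of `jacobiForm` along the direction `(1, 1)`. -/
def jacobiFormDeriv (N : ℕ) (p q X Y : ℝ) : ℝ :=
  ∑ ij ∈ antidiagonal N, genBinom p ij.2 * genBinom q ij.1 *
    (ij.1 * X ^ (ij.1 - 1) * Y ^ ij.2 + ij.2 * X ^ ij.1 * Y ^ (ij.2 - 1))

lemma prod_range_succ_sub_natCast (α : ℝ) (j : ℕ) :
    ∏ i ∈ Finset.range (j + 1), (α - i) = α * ∏ i ∈ Finset.range j, (α - 1 - i) := by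
  rw [Finset.prod_range_succ', mul_comm]
  congr 1
  · simp
  · refine Finset.prod_congr rfl fun i _ => ?_
    push_cast
    ring

lemma genBinom_zero (α : ℝ) : genBinom α 0 = 1 := by simp [genBinom]

lemma sub_mul_genBinom (α : ℝ) (j : ℕ) :
    (α - j) * genBinom α j = α * genBinom (α - 1) j := by
  have h := prod_range_succ_sub_natCast α j
  rw [Finset.prod_range_succ] at h
  unfold genBinom
  rw [mul_div_assoc', mul_div_assoc', ← h, mul_comm]

lemma succ_mul_genBinom_succ (α : ℝ) (j : ℕ) :
    ((j : ℝ) + 1) * genBinom α (j + 1) = α * genBinom (α - 1) j := by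
  unfold genBinom
  rw [prod_range_succ_sub_natCast, Nat.factorial_succ]
  push_cast
  field_simp

lemma genBinom_add_one_succ (α : ℝ) (j : ℕ) :
    genBinom (α + 1) (j + 1) = genBinom α (j + 1) + genBinom α j := by
  unfold genBinom
  rw [prod_range_succ_sub_natCast, Finset.prod_range_succ, Nat.factorial_succ]
  push_cast
  simp only [add_sub_cancel_right]
  field_simp
  ring

lemma natCast_mul_pow_pred_mul (r : ℝ) (j : ℕ) : (j : ℝ) * r ^ (j - 1) * r = j * r ^ j := by
  cases j <;> simp [pow_succ, mul_assoc]

lemma jacobiForm_swap (N : ℕ) (p q X Y : ℝ) : jacobiForm N p q X Y = jacobiForm N q p Y X := by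
  unfold jacobiForm
  rw [← Finset.Nat.sum_antidiagonal_swap]
  refine Finset.sum_congr rfl fun ij _ => ?_
  simp only [Prod.fst_swap, Prod.snd_swap]
  ring

lemma jacobiFormDeriv_swap (N : ℕ) (p q X Y : ℝ) :
    jacobiFormDeriv N p q X Y = jacobiFormDeriv N q p Y X := by
  unfold jacobiFormDeriv
  rw [← Finset.Nat.sum_antidiagonal_swap]
  refine Finset.sum_congr rfl fun ij _ => ?_
  simp only [Prod.fst_swap, Prod.snd_swap]
  ring

lemma jacobiForm_ladder (N : ℕ) (p q X Y : ℝ) :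
    (q - N) * jacobiForm N p q X Y + Y * jacobiFormDeriv N p q X Y
      = q * jacobiForm N (p + 1) (q - 1) X Y := by
  have key : (q - N) * jacobiForm N p q X Y + Y * jacobiFormDeriv N p q X Y
      = ∑ ij ∈ Finset.HasAntidiagonal.antidiagonal N,
          q * (genBinom p ij.2 * genBinom (q - 1) ij.1 * X ^ ij.1 * Y ^ ij.2)
        + ∑ ij ∈ Finset.HasAntidiagonal.antidiagonal N,
          genBinom p ij.2 * genBinom q ij.1 * (ij.1 * X ^ (ij.1 - 1) * Y ^ (ij.2 + 1)) := by
    unfold jacobiForm jacobiFormDeriv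
    rw [Finset.mul_sum, Finset.mul_sum, ← Finset.sum_add_distrib, ← Finset.sum_add_distrib]
    refine Finset.sum_congr rfl fun ij hij => ?_
    have hN : (N : ℝ) = ij.1 + ij.2 := by
      rw [← Finset.HasAntidiagonal.mem_antidiagonal.mp hij]
      push_cast
      ring
    rw [hN]
    linear_combination genBinom p ij.2 * X ^ ij.1 * Y ^ ij.2 * sub_mul_genBinom q ij.1
      + genBinom p ij.2 * genBinom q ij.1 * X ^ ij.1 * natCast_mul_pow_pred_mul Y ij.2
  rw [key]
  unfold jacobiForm
  cases N with
  | zero => simp [genBinom_zero]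
  | succ M =>
    rw [Finset.Nat.sum_antidiagonal_succ', Finset.Nat.sum_antidiagonal_succ,
      Finset.Nat.sum_antidiagonal_succ', mul_add, Finset.mul_sum]
    simp only [genBinom_zero, CharP.cast_eq_zero, zero_mul, mul_zero, zero_add]
    rw [add_assoc, ← Finset.sum_add_distrib]
    congr 1
    refine Finset.sum_congr rfl fun ij _ => ?_
    rw [genBinom_add_one_succ]
    push_cast
    linear_combination genBinom p ij.2 * X ^ ij.1 * Y ^ (ij.2 + 1)
      * succ_mul_genBinom_succ q ij.1

lemma jacobiForm_ladder' (N : ℕ) (p q X Y : ℝ) :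
    (p - N) * jacobiForm N p q X Y + X * jacobiFormDeriv N p q X Y
      = p * jacobiForm N (p - 1) (q + 1) X Y := by
  rw [jacobiForm_swap N p, jacobiFormDeriv_swap, jacobiForm_swap N (p - 1)]
  exact jacobiForm_ladder N q p Y X

lemma jacobiP_natCast (N : ℕ) (α β z : ℝ) :
    jacobiP N α β z = jacobiForm N (N + α) (N + β) ((z - 1) / 2) ((z + 1) / 2) := by
  unfold jacobiP jacobiForm
  rw [if_neg (by lia), Finset.Nat.sum_antidiagonal_eq_sum_range_succ_mk]
  simp

/-- The derivative of the Jacobi polynomial `P_N^{(α,β)}` at `z`. -/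
def jacobiPDeriv (N : ℕ) (α β z : ℝ) : ℝ :=
  jacobiFormDeriv N (N + α) (N + β) ((z - 1) / 2) ((z + 1) / 2) / 2

lemma hasDerivAt_jacobiP (N : ℕ) (α β z : ℝ) :
    HasDerivAt (jacobiP N α β) (jacobiPDeriv N α β z) z := by
  rw [funext (jacobiP_natCast N α β)]
  unfold jacobiPDeriv jacobiFormDeriv jacobiForm
  rw [Finset.sum_div]
  refine HasDerivAt.fun_sum fun ij _ => ?_
  have hX : HasDerivAt (fun z : ℝ => (z - 1) / 2) (1 / 2) z :=
    ((hasDerivAt_id z).sub_const 1).div_const 2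
  have hY : HasDerivAt (fun z : ℝ => (z + 1) / 2) (1 / 2) z :=
    ((hasDerivAt_id z).add_const 1).div_const 2
  refine (((hX.fun_pow ij.1).const_mul _).fun_mul (hY.fun_pow ij.2)).congr_deriv ?_
  ring

lemma jacobiP_ladder (N : ℕ) (α β z : ℝ) :
    β * jacobiP N α β z + (1 + z) * jacobiPDeriv N α β z
      = (N + β) * jacobiP N (α + 1) (β - 1) z := by
  rw [jacobiP_natCast, jacobiP_natCast, ← add_assoc, ← add_sub_assoc, ← jacobiForm_ladder]
  unfold jacobiPDeriv
  ring

lemma jacobiP_ladder' (N : ℕ) (α β z : ℝ) :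
    α * jacobiP N α β z - (1 - z) * jacobiPDeriv N α β z
      = (N + α) * jacobiP N (α - 1) (β + 1) z := by
  rw [jacobiP_natCast, jacobiP_natCast, ← add_assoc, ← add_sub_assoc, ← jacobiForm_ladder']
  unfold jacobiPDeriv
  ring

lemma koornP_natCast_add (N K : ℕ) (a b c d x y : ℝ) :
    koornP ((K + N : ℕ) : ℤ) K a b c d x y =
      jacobiP N (2 * K + b + c + d + 1) a (2 * x - 1) * (1 - x) ^ K *
        jacobiP K c b (-1 + 2 * y / (1 - x)) := by
  unfold koornP
  rw [if_neg (by lia)]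
  simp

lemma deriv_koornP_snd (N K : ℕ) (a b c d x y : ℝ) :
    deriv (koornP ((K + N : ℕ) : ℤ) K a b c d x) y =
      jacobiP N (2 * K + b + c + d + 1) a (2 * x - 1) * (1 - x) ^ K *
        (jacobiPDeriv K c b (-1 + 2 * y / (1 - x)) * (2 / (1 - x))) := by
  rw [funext (koornP_natCast_add N K a b c d x)]
  have hw : HasDerivAt (fun y : ℝ => -1 + 2 * y / (1 - x)) (2 / (1 - x)) y := by
    simpa using (((hasDerivAt_id y).const_mul 2).div_const (1 - x)).const_add (-1)
  exact (((hasDerivAt_jacobiP K c b _).comp y hw).const_mul _).deriv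

lemma deriv_koornP_fst (N K : ℕ) (a b c d x y : ℝ) (hx : x ≠ 1) :
    deriv (fun x' => koornP ((K + N : ℕ) : ℤ) K a b c d x' y) x =
      (jacobiPDeriv N (2 * K + b + c + d + 1) a (2 * x - 1) * 2 * (1 - x) ^ K
        - jacobiP N (2 * K + b + c + d + 1) a (2 * x - 1) * (K * (1 - x) ^ (K - 1)))
          * jacobiP K c b (-1 + 2 * y / (1 - x))
        + jacobiP N (2 * K + b + c + d + 1) a (2 * x - 1) * (1 - x) ^ K *
          (jacobiPDeriv K c b (-1 + 2 * y / (1 - x)) * (2 * y / (1 - x) / (1 - x))) := by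
  have hs : (1 - x) ≠ 0 := sub_ne_zero.mpr hx.symm
  rw [funext (koornP_natCast_add N K a b c d · y)]
  have h1 : HasDerivAt (fun x : ℝ => 1 - x) (-1) x := (hasDerivAt_id x).const_sub 1
  have hz : HasDerivAt (fun x : ℝ => 2 * x - 1) 2 x := by
    simpa using ((hasDerivAt_id x).const_mul 2).sub_const 1
  have hw : HasDerivAt (fun x : ℝ => -1 + 2 * y / (1 - x)) (2 * y / (1 - x) / (1 - x)) x := by
    refine (((hasDerivAt_const x (2 * y)).fun_div h1 hs).const_add (-1)).congr_deriv ?_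
    field_simp
    ring
  have hJ := (hasDerivAt_jacobiP N (2 * K + b + c + d + 1) a _).comp x hz
  have hG := (hasDerivAt_jacobiP K c b _).comp x hw
  refine (((hJ.mul (h1.fun_pow K)).mul hG).congr_deriv ?_).deriv
  simp only [Function.comp_apply, Pi.mul_apply]
  ring

theorem koorn_ladder_M60 (a b c d : ℝ) (n k : ℤ) (hk : 0 ≤ k) (hnk : k ≤ n)
    (x y : ℝ) (hx : x ≠ 1) :
    (a + x * (k : ℝ) / (1 - x)) * koornP n k a b c d x y
        + x * deriv (fun x' => koornP n k a b c d x' y) x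
        - (x * y / (1 - x)) * deriv (koornP n k a b c d x) y
      = ((n : ℝ) - (k : ℝ) + a) * koornP n k (a - 1) b c (d + 1) x y ∧
    ((k : ℝ) + b + c + d + 1) * koornP n k a b c d x y
        - (1 - x) * deriv (fun x' => koornP n k a b c d x' y) x
        + y * deriv (koornP n k a b c d x) y
      = ((n : ℝ) + (k : ℝ) + (a + b + c + d) - a + 1)
          * koornP n k (a + 1) b c (d - 1) x y := by
  obtain ⟨K, rfl⟩ := Int.eq_ofNat_of_zero_le hk
  obtain ⟨N, hN⟩ := Int.eq_ofNat_of_zero_le (sub_nonneg.mpr hnk)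
  obtain rfl : n = ((K + N : ℕ) : ℤ) := by push_cast; lia
  have hs : (1 - x) ≠ 0 := sub_ne_zero.mpr hx.symm
  have hK := natCast_mul_pow_pred_mul (1 - x) K
  have hK' : (K : ℝ) * (1 - x) ^ (K - 1) = K * (1 - x) ^ K / (1 - x) := by
    rw [eq_div_iff hs, hK]
  have e₁ : 2 * (K : ℝ) + b + c + (d + 1) + 1 = 2 * K + b + c + d + 1 + 1 := by ring
  have e₂ : 2 * (K : ℝ) + b + c + (d - 1) + 1 = 2 * K + b + c + d + 1 - 1 := by ring
  have l₁ := jacobiP_ladder N (2 * K + b + c + d + 1) a (2 * x - 1)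
  have l₂ := jacobiP_ladder' N (2 * K + b + c + d + 1) a (2 * x - 1)
  rw [deriv_koornP_fst N K a b c d x y hx, deriv_koornP_snd, koornP_natCast_add,
    koornP_natCast_add, koornP_natCast_add, hK', e₁, e₂]
  push_cast
  set G := jacobiP K c b (-1 + 2 * y / (1 - x))
  constructor
  · linear_combination (1 - x) ^ K * G * l₁
  · generalize jacobiPDeriv K c b (-1 + 2 * y / (1 - x)) = G'
    generalize jacobiP N (2 * K + b + c + d + 1) a (2 * x - 1) = J at *
    trans ((2 * K + b + c + d + 1) * J - (1 - (2 * x - 1)) *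
      jacobiPDeriv N (2 * K + b + c + d + 1) a (2 * x - 1)) * ((1 - x) ^ K * G)
    · field_simp
      ring
    · rw [l₂]
      ring
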